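/- arXiv:1506.03059 — 2 statements merged into one kernel-verified Lean document; each statement's English description precedes it below -/
import Mathlib

section
/- For any dimension d ∈ ℕ (d ≥ 1) and constants c > 0 and p > 0, there do not exist mappings Z : ℝ^d → ℝ^d and U : ℝ^d → ℝ^d (with U taking values with all coordinates nonnegative), a real inner product space H, and a feature map Φ : ℝ^d × ℝ^d → H such that for all x, z ∈ ℝ^d and all u ∈ ℝ^d with nonnegative coordinates, ⟪Φ(Z(x), U(x)), Φ(z, u)⟫ = exp(−c · Σ_{i=1}^d u_i · |x_i − z_i|^p). In other words, the weighted ℓp similarity exponential exp(−c Σ_i u_i |x_i − z_i|^p), viewed as a function of (x, (z,u)), cannot be realized by any fixed kernel (inner product of feature maps) after re-encoding the input x through any maps Z and U. -/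
/-- There is no re-encoding `(Z, U)` of the input and no feature map `Φ` into a real
inner product space whose inner product realizes the weighted ℓp similarity exponential
`exp (-c * ∑ i, u i * |x i - z i| ^ p)`. -/
theorem no_kernel_for_weighted_lp_similarity
    (d : ℕ) (hd : 1 ≤ d) (c p : ℝ) (hc : 0 < c) (hp : 0 < p) :
    ¬ ∃ (Z U : (Fin d → ℝ) → (Fin d → ℝ)) (H : Type)
        (_ : NormedAddCommGroup H) (_ : InnerProductSpace ℝ H)
        (Φ : (Fin d → ℝ) × (Fin d → ℝ) → H),
        (∀ x i, 0 ≤ U x i) ∧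
        ∀ (x z u : Fin d → ℝ), (∀ i, 0 ≤ u i) →
          (inner ℝ (Φ (Z x, U x)) (Φ (z, u)) : ℝ) =
            Real.exp (-c * ∑ i, u i * |x i - z i| ^ p) := by
  rintro ⟨Z, U, H, _, _, Φ, hU, h⟩
  set F : (Fin d → ℝ) → H := fun x => Φ (Z x, U x) with hF
  have hFF : ∀ x y, inner ℝ (F x) (F y) = Real.exp (-c * ∑ i, U x i * |y i - Z x i| ^ p) := by
    intro x y
    rw [real_inner_comm]
    exact h y (Z x) (U x) (hU x)
  have hFn : ∀ x, ‖F x‖ ^ 2 ≤ 1 := by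
    intro x
    rw [← real_inner_self_eq_norm_sq, hFF, Real.exp_le_one_iff]
    have : 0 ≤ ∑ i, U x i * |x i - Z x i| ^ p :=
      Finset.sum_nonneg fun i _ => mul_nonneg (hU x i) (Real.rpow_nonneg (abs_nonneg _) _)
    nlinarith
  -- U never vanishes
  have hU0 : ∀ x, ∃ i, 0 < U x i := by
    intro x
    by_contra hcon
    push Not at hcon
    have hz : ∀ i, U x i = 0 := fun i => le_antisymm (hcon i) (hU x i)
    have h1 : ∀ y, inner ℝ (F x) (F y) = (1 : ℝ) := by
      intro y
      rw [hFF]; simp [hz]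
    have heq : ∀ y, F x = F y := by
      intro y
      have e := norm_sub_sq_real (F x) (F y)
      rw [h1 y] at e
      have h2 := hFn x
      have h3 := hFn y
      have h4 : ‖F x - F y‖ ^ 2 ≤ 0 := by linarith
      have h5 : ‖F x - F y‖ = 0 := by
        have := sq_nonneg ‖F x - F y‖
        exact pow_eq_zero_iff (two_ne_zero) |>.1 (le_antisymm h4 this)
      exact sub_eq_zero.1 (norm_eq_zero.1 h5)
    have a0 := h 0 0 1 (fun i => by simp)
    have a1 := h 1 0 1 (fun i => by simp)
    have e : Φ (Z 0, U 0) = Φ (Z 1, U 1) := (heq 0).symm.trans (heq 1)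
    rw [e, a1] at a0
    have a2 := Real.exp_injective a0
    simp [Real.zero_rpow hp.ne'] at a2
    rcases a2 with a2 | a2
    · exact hc.ne' a2
    · omega
  have hT : ∀ x, Filter.Tendsto (fun t : ℝ => inner ℝ (F x) (F fun _ => t)) Filter.atTop
      (nhds (0 : ℝ)) := by
    intro x
    obtain ⟨i, hi⟩ := hU0 x
    simp only [hFF]
    have t1 : Filter.Tendsto (fun t : ℝ => |t - Z x i| ^ p) Filter.atTop Filter.atTop :=
      (tendsto_rpow_atTop hp).comp (Filter.tendsto_abs_atTop_atTop.comp
        (Filter.tendsto_atTop_add_const_right _ (-Z x i) Filter.tendsto_id))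
    have t2 : Filter.Tendsto (fun t : ℝ => ∑ i, U x i * |t - Z x i| ^ p)
        Filter.atTop Filter.atTop := by
      refine Filter.tendsto_atTop_mono (fun t => ?_) (t1.const_mul_atTop hi)
      exact Finset.single_le_sum (f := fun i => U x i * |t - Z x i| ^ p)
        (fun i _ => mul_nonneg (hU x i) (Real.rpow_nonneg (abs_nonneg _) _)) (Finset.mem_univ i)
    exact Real.tendsto_exp_atBot.comp (t2.const_mul_atTop_of_neg (neg_lt_zero.2 hc))
  have key : ∀ n : ℕ, ∃ w : H, ‖w‖ ^ 2 ≤ 2 * n ∧ inner ℝ w (Φ (0, 0)) = (n : ℝ) ∧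
      Filter.Tendsto (fun t : ℝ => inner ℝ w (F fun _ => t)) Filter.atTop (nhds (0 : ℝ)) := by
    intro n
    induction n with
    | zero => exact ⟨0, by simp, by simp, by simp⟩
    | succ n ih =>
      obtain ⟨w, h1, h2, h3⟩ := ih
      obtain ⟨t, ht⟩ := (h3.eventually (gt_mem_nhds (show (0 : ℝ) < 1 / 2 by norm_num))).exists
      refine ⟨w + F fun _ => t, ?_, ?_, ?_⟩
      · have := hFn fun _ => t
        rw [norm_add_sq_real]
        push_cast
        linarith
      · rw [inner_add_left, h2]
        have := h (fun _ => t) 0 0 (fun i => by simp)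
        simp only [hF]
        rw [this]
        simp
      · simp only [inner_add_left]
        simpa using h3.add (hT fun _ => t)
  obtain ⟨n, hn⟩ := exists_nat_gt (2 * ‖Φ (0, 0)‖ ^ 2)
  obtain ⟨w, h1, h2, -⟩ := key n
  have hcs := abs_real_inner_le_norm w (Φ (0, 0))
  rw [h2, Nat.abs_cast] at hcs
  have hn0 : (0 : ℝ) < n := lt_of_le_of_lt (by positivity) hn
  have h5 : (n : ℝ) ^ 2 ≤ ‖w‖ ^ 2 * ‖Φ (0, 0)‖ ^ 2 := by
    rw [← mul_pow]
    exact pow_le_pow_left₀ hn0.le hcs 2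
  have h6 : ‖w‖ ^ 2 * ‖Φ (0, 0)‖ ^ 2 ≤ 2 * n * ‖Φ (0, 0)‖ ^ 2 :=
    mul_le_mul_of_nonneg_right h1 (by positivity)
  nlinarith
end

section
/- The Generalized Gaussian kernel is positive semidefinite: for every β > 0 and every p with 0 < p ≤ 2, for any m ≥ 1 and any points x_1, …, x_m ∈ ℝ^d, the m × m Gram matrix with entries M_{ij} = exp(−β·Σ_{k=1}^d |x_{i,k} − x_{j,k}|^p) is symmetric positive semidefinite. In particular, the cases p = 2 and p = 1 yield the RBF (Gaussian) and Laplacian kernels respectively. -/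
open MeasureTheory Set

lemma gg_psd_iff {m : ℕ} (M : Fin m → Fin m → ℝ) :
    (Matrix.of M).PosSemidef ↔ (∀ i j, M i j = M j i) ∧ ∀ c : Fin m → ℝ, 0 ≤ ∑ i, ∑ j, c i * c j * M i j := by
  rw [Matrix.posSemidef_iff_dotProduct_mulVec]
  refine and_congr ?_ (forall_congr' fun c => ?_)
  · rw [Matrix.IsHermitian.ext_iff]
    simp only [Matrix.of_apply, star_trivial]
    exact ⟨fun h i j => h j i, fun h i j => h j i⟩
  · have : star c ⬝ᵥ (Matrix.of M).mulVec c = ∑ i, ∑ j, c i * c j * M i j := by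
      simp only [dotProduct, Matrix.mulVec, Finset.mul_sum, star_trivial, Matrix.of_apply]
      refine Finset.sum_congr rfl fun i _ => Finset.sum_congr rfl fun j _ => by ring
    rw [this]

lemma gg_mul {m : ℕ} {M N : Fin m → Fin m → ℝ} (hM : (Matrix.of M).PosSemidef)
    (hN : (Matrix.of N).PosSemidef) : (Matrix.of fun i j => M i j * N i j).PosSemidef :=
  hM.hadamard hN

lemma gg_one {m : ℕ} (v : Fin m → ℝ) : (Matrix.of fun i j => v i * v j).PosSemidef := by
  rw [gg_psd_iff]
  refine ⟨fun i j => mul_comm _ _, fun c => ?_⟩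
  have : ∑ i, ∑ j, c i * c j * (v i * v j) = (∑ i, c i * v i) * (∑ i, c i * v i) := by
    rw [Finset.sum_mul_sum]
    refine Finset.sum_congr rfl fun i _ => Finset.sum_congr rfl fun j _ => by ring
  rw [this]
  exact mul_self_nonneg _

lemma gg_pow {m : ℕ} {M : Fin m → Fin m → ℝ} (hM : (Matrix.of M).PosSemidef) (n : ℕ) :
    (Matrix.of fun i j => M i j ^ n).PosSemidef := by
  induction n with
  | zero => simpa using gg_one (fun _ : Fin m => (1:ℝ))
  | succ n ih => simpa only [pow_succ] using gg_mul ih hM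

lemma gg_exp {m : ℕ} {M : Fin m → Fin m → ℝ} (hM : (Matrix.of M).PosSemidef) :
    (Matrix.of fun i j => Real.exp (M i j)).PosSemidef := by
  rw [gg_psd_iff]
  refine ⟨fun i j => by rw [((gg_psd_iff M).1 hM).1 i j], fun c => ?_⟩
  have h : HasSum (fun n : ℕ => ∑ i, ∑ j, c i * c j * (M i j ^ n / (n.factorial : ℝ)))
      (∑ i, ∑ j, c i * c j * Real.exp (M i j)) := by
    refine hasSum_sum fun i _ => hasSum_sum fun j _ => HasSum.mul_left _ ?_
    rw [Real.exp_eq_exp_ℝ]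
    exact NormedSpace.expSeries_div_hasSum_exp _
  refine h.nonneg fun n => ?_
  have := ((gg_psd_iff _).1 (gg_pow hM n)).2 c
  have h2 : ∑ i, ∑ j, c i * c j * (M i j ^ n / (n.factorial : ℝ))
      = (∑ i, ∑ j, c i * c j * M i j ^ n) / (n.factorial : ℝ) := by
    simp only [Finset.sum_div, mul_div_assoc]
  rw [h2]
  positivity

lemma gg_int (p : ℝ) (hp : 0 < p) (hp2 : p < 2) :
    IntegrableOn (fun u : ℝ => (1 - Real.cos u) * u ^ (-1 - p)) (Ioi 0) := by
  have hmeas : Measurable (fun u : ℝ => (1 - Real.cos u) * u ^ (-1 - p)) := by fun_prop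
  rw [← Ioc_union_Ioi_eq_Ioi (zero_le_one' ℝ)]
  refine IntegrableOn.union ?_ ?_
  · have h1 : IntegrableOn (fun u : ℝ => u ^ (1 - p)) (Ioc 0 1) := by
      rw [← intervalIntegrable_iff_integrableOn_Ioc_of_le zero_le_one]
      exact intervalIntegral.intervalIntegrable_rpow' (by linarith)
    refine Integrable.mono' h1 hmeas.aestronglyMeasurable ?_
    filter_upwards [ae_restrict_mem measurableSet_Ioc] with u hu
    have hu0 := hu.1
    have e : u ^ (1 - p) = u ^ 2 * u ^ (-1 - p) := by
      rw [← Real.rpow_natCast, ← Real.rpow_add hu0]; congr 1; push_cast; ring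
    have := Real.one_sub_sq_div_two_le_cos (x := u)
    have := Real.cos_le_one u
    rw [Real.norm_of_nonneg (mul_nonneg (by linarith) (by positivity)), e]
    gcongr
    nlinarith
  · have h1 : IntegrableOn (fun u : ℝ => 2 * u ^ (-1 - p)) (Ioi 1) :=
      (integrableOn_Ioi_rpow_of_lt (by linarith) one_pos).const_mul 2
    refine Integrable.mono' h1 hmeas.aestronglyMeasurable ?_
    filter_upwards [ae_restrict_mem measurableSet_Ioi] with u hu
    have hu0 : 0 < u := lt_trans one_pos hu
    have := Real.neg_one_le_cos u
    have := Real.cos_le_one u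
    rw [Real.norm_of_nonneg (mul_nonneg (by linarith) (by positivity))]
    gcongr
    linarith

lemma gg_scale (p t : ℝ) (ht : 0 < t) (s : ℝ) (hs : 0 < s) :
    (1 - Real.cos (s * t)) * s ^ (-1 - p)
     = t ^ (1 + p) * ((1 - Real.cos (t * s)) * (t * s) ^ (-1 - p)) := by
  rw [Real.mul_rpow ht.le hs.le, mul_comm s t]
  have : t ^ (1 + p) * t ^ (-1 - p) = 1 := by
    rw [← Real.rpow_add ht]; ring_nf; simp
  linear_combination -(1 - Real.cos (t * s)) * s ^ (-1 - p) * this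

lemma gg_int' (p : ℝ) (hp : 0 < p) (hp2 : p < 2) (t : ℝ) :
    IntegrableOn (fun s : ℝ => (1 - Real.cos (s * t)) * s ^ (-1 - p)) (Ioi 0) ∧
    ∫ s in Ioi 0, (1 - Real.cos (s * t)) * s ^ (-1 - p) =
      |t| ^ p * ∫ s in Ioi (0:ℝ), (1 - Real.cos s) * s ^ (-1 - p) := by
  wlog ht : 0 ≤ t generalizing t
  · have := this (-t) (by linarith)
    simpa only [mul_neg, Real.cos_neg, abs_neg] using this
  rcases ht.eq_or_lt with rfl | ht
  · simp [Real.zero_rpow hp.ne']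
  constructor
  · have h := (integrableOn_Ioi_comp_mul_left_iff (fun u : ℝ => (1 - Real.cos u) * u ^ (-1 - p)) 0 ht).2
      (by simpa using gg_int p hp hp2)
    refine IntegrableOn.congr_fun (h.const_mul (t ^ (1 + p))) ?_ measurableSet_Ioi
    intro s hs
    exact (gg_scale p t ht s hs).symm
  · rw [setIntegral_congr_fun measurableSet_Ioi (fun s hs => gg_scale p t ht s hs),
      integral_const_mul,
      integral_comp_mul_left_Ioi (fun u : ℝ => (1 - Real.cos u) * u ^ (-1 - p)) 0 ht, abs_of_pos ht,
      mul_zero, smul_eq_mul, ← mul_assoc, Real.rpow_add ht, Real.rpow_one]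
    field_simp

lemma gg_pos (p : ℝ) (hp : 0 < p) (hp2 : p < 2) :
    0 < ∫ s in Ioi (0:ℝ), (1 - Real.cos s) * s ^ (-1 - p) := by
  rw [setIntegral_pos_iff_support_of_nonneg_ae ?_ (gg_int p hp hp2)]
  · refine lt_of_lt_of_le ?_ (measure_mono (s := Ioo (0:ℝ) 1) ?_)
    · simp
    · intro u hu
      refine ⟨?_, hu.1⟩
      have h1 : Real.cos u ≠ 1 := fun h => hu.1.ne' <|
        (Real.cos_eq_one_iff_of_lt_of_lt (by linarith [hu.1, Real.pi_pos])
          (by linarith [hu.2, Real.pi_gt_three])).1 h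
      have h2 := Real.rpow_pos_of_pos hu.1 (-1 - p)
      exact mul_ne_zero (sub_ne_zero.2 h1.symm) h2.ne'
  · filter_upwards [ae_restrict_mem measurableSet_Ioi] with u hu
    exact mul_nonneg (by linarith [Real.cos_le_one u]) (Real.rpow_nonneg (le_of_lt hu) _)

lemma gg_cnd {m : ℕ} (p : ℝ) (hp : 0 < p) (hp2 : p ≤ 2) (y : Fin m → ℝ) :
    (Matrix.of fun i j => |y i| ^ p + |y j| ^ p - |y i - y j| ^ p).PosSemidef := by
  rw [gg_psd_iff]
  refine ⟨fun i j => by rw [abs_sub_comm]; ring, fun c => ?_⟩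
  rcases hp2.eq_or_lt with rfl | hp2
  · have := ((gg_psd_iff _).1 (gg_one y)).2 c
    have e : ∑ i, ∑ j, c i * c j * (|y i| ^ (2:ℝ) + |y j| ^ (2:ℝ) - |y i - y j| ^ (2:ℝ))
       = 2 * ∑ i, ∑ j, c i * c j * (y i * y j) := by
      simp only [Finset.mul_sum, Real.rpow_two, sq_abs]
      refine Finset.sum_congr rfl fun i _ => Finset.sum_congr rfl fun j _ => by ring
    rw [e]; positivity
  have hC := gg_pos p hp hp2
  set C := ∫ s in Ioi (0:ℝ), (1 - Real.cos s) * s ^ (-1 - p) with hCdef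
  have hI := fun t => (gg_int' p hp hp2 t).1
  have hV := fun t => (gg_int' p hp hp2 t).2
  refine nonneg_of_mul_nonneg_left (b := C) ?_ hC
  have e : (∑ i, ∑ j, c i * c j * (|y i| ^ p + |y j| ^ p - |y i - y j| ^ p)) * C
     = ∫ s in Ioi (0:ℝ), ∑ i, ∑ j, c i * c j * ((1 - Real.cos (s * y i)) * s ^ (-1 - p) +
        (1 - Real.cos (s * y j)) * s ^ (-1 - p)
        - (1 - Real.cos (s * (y i - y j))) * s ^ (-1 - p)) := by
    have hij : ∀ i j, Integrable (fun s => c i * c j * ((1 - Real.cos (s * y i)) * s ^ (-1 - p) +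
        (1 - Real.cos (s * y j)) * s ^ (-1 - p)
        - (1 - Real.cos (s * (y i - y j))) * s ^ (-1 - p))) (volume.restrict (Ioi (0:ℝ))) :=
      fun i j => (((hI _).add (hI _)).sub (hI _)).const_mul _
    rw [integral_finsetSum _ (fun i _ => integrable_finsetSum _ fun j _ => hij i j), Finset.sum_mul]
    refine Finset.sum_congr rfl fun i _ => ?_
    rw [integral_finsetSum _ (fun j _ => hij i j), Finset.sum_mul]
    refine Finset.sum_congr rfl fun j _ => ?_
    have hadd : Integrable (fun s => (1 - Real.cos (s * y i)) * s ^ (-1 - p) +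
        (1 - Real.cos (s * y j)) * s ^ (-1 - p)) (volume.restrict (Ioi (0:ℝ))) :=
      (hI _).add (hI _)
    rw [integral_const_mul, integral_sub hadd (hI _), integral_add (hI _) (hI _),
      hV, hV, hV]
    ring
  rw [e]
  refine setIntegral_nonneg measurableSet_Ioi fun s hs => ?_
  have h1 := ((gg_psd_iff _).1 (gg_one fun i => 1 - Real.cos (s * y i))).2 c
  have h2 := ((gg_psd_iff _).1 (gg_one fun i => Real.sin (s * y i))).2 c
  have h3 : 0 ≤ s ^ (-1 - p) := Real.rpow_nonneg (le_of_lt hs) _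
  refine le_of_le_of_eq (mul_nonneg h3 (add_nonneg h1 h2)) ?_
  simp only [← Finset.sum_add_distrib, Finset.mul_sum]
  refine Finset.sum_congr rfl fun i _ => Finset.sum_congr rfl fun j _ => ?_
  rw [mul_sub s, Real.cos_sub]
  ring

lemma gg_one_dim {m : ℕ} (β p : ℝ) (hβ : 0 < β) (hp : 0 < p) (hp2 : p ≤ 2) (y : Fin m → ℝ) :
    (Matrix.of fun i j => Real.exp (-β * |y i - y j| ^ p)).PosSemidef := by
  have h1 : (Matrix.of fun i j => β * (|y i| ^ p + |y j| ^ p - |y i - y j| ^ p)).PosSemidef :=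
    (gg_cnd p hp hp2 y).smul hβ.le
  have h2 := gg_mul (gg_one fun i => Real.exp (-β * |y i| ^ p)) (gg_exp h1)
  convert h2 using 4 with i j
  rw [← Real.exp_add, ← Real.exp_add]
  ring_nf

/-- The Generalized Gaussian kernel `exp (-β * ∑ k, |x_k - z_k| ^ p)` with `0 < p ≤ 2`
and `β > 0` is positive semidefinite. -/
theorem generalized_gaussian_kernel_posSemidef (d : ℕ) (β p : ℝ) (hβ : 0 < β)
    (hp : 0 < p) (hp2 : p ≤ 2) (m : ℕ) (hm : 1 ≤ m) (x : Fin m → Fin d → ℝ) :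
    (Matrix.of fun i j : Fin m =>
      Real.exp (-β * ∑ k, |x i k - x j k| ^ p)).PosSemidef := by
  suffices h : ∀ s : Finset (Fin d), (Matrix.of fun i j : Fin m =>
      Real.exp (-β * ∑ k ∈ s, |x i k - x j k| ^ p)).PosSemidef from h _
  intro s
  induction s using Finset.induction_on with
  | empty => simpa using gg_one (fun _ : Fin m => (1:ℝ))
  | insert a s ha ih =>
    have := gg_mul (gg_one_dim β p hβ hp hp2 fun i => x i a) ih
    simpa only [Finset.sum_insert ha, mul_add, Real.exp_add] using this
end
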